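/- If β_n ≪ n/log n, then E[L(WST^{β_n}(K_n))] = (1+o(1)) · (n/β_n) · (1 − β_n e^{−β_n} − e^{−β_n})/(1 − e^{−β_n}), where K_n is the complete graph on n vertices. -/

import Mathlib

open MeasureTheory Filter Finset

noncomputable section

set_option linter.unusedSectionVars false

namespace WSTPaper

variable {V : Type} [Fintype V] [DecidableEq V]

open scoped Classical in
/-- The edge sets of spanning trees of `G`. -/
def spanningTrees (G : SimpleGraph V) : Finset (Finset (Sym2 V)) :=
  Finset.univ.filter
    (fun T => ↑T ⊆ G.edgeSet ∧ (SimpleGraph.fromEdgeSet (↑T : Set (Sym2 V))).IsTree)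

/-- Weight of a spanning tree: product of its edge conductances. -/
def treeWeight (c : Sym2 V → ℝ) (T : Finset (Sym2 V)) : ℝ := ∏ e ∈ T, c e

/-- Partition function of the weighted spanning tree measure. -/
def partZ (G : SimpleGraph V) (c : Sym2 V → ℝ) : ℝ := ∑ T ∈ spanningTrees G, treeWeight c T

/-- Product of i.i.d. Uniform[0,1] label measures. -/
def labelMeasure (ι : Type) [Fintype ι] : Measure (ι → ℝ) :=
  Measure.pi fun _ => (volume.restrict (Set.Icc (0:ℝ) 1))

/-- `E[L(WST^β(Kₙ))]`: the expected total length `L(T) = Σ_{e ∈ T} U_e` of the weighted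
spanning tree of the complete graph `Kₙ`, where, conditionally on the i.i.d. Uniform[0,1]
labels `U`, the tree `T` is sampled with probability proportional to `∏_{e∈T} exp(-β U_e)`. -/
def expLengthK (n : ℕ) (β : ℝ) : ℝ :=
  ∫ u : Sym2 (Fin n) → ℝ,
    (∑ T ∈ spanningTrees (⊤ : SimpleGraph (Fin n)),
        treeWeight (fun e => Real.exp (-β * u e)) T * (∑ e ∈ T, u e)) /
      partZ (⊤ : SimpleGraph (Fin n)) (fun e => Real.exp (-β * u e))
    ∂(labelMeasure (Sym2 (Fin n)))

/-- The graph whose edges are the non-loops in `F`. -/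
abbrev graphOf (F : Finset (Sym2 V)) : SimpleGraph V :=
  SimpleGraph.fromEdgeSet (↑F : Set (Sym2 V))

open scoped Classical in
lemma mem_spanningTrees_top {T : Finset (Sym2 V)} :
    T ∈ spanningTrees (⊤ : SimpleGraph V) ↔ (∀ e ∈ T, ¬ e.IsDiag) ∧ (graphOf T).IsTree := by
  rw [spanningTrees, mem_filter_univ]
  refine and_congr_left fun _ => ?_
  simp only [Set.subset_def, mem_coe]
  refine forall₂_congr fun e _ => ?_
  induction e with | _ x y => simp

lemma edgeFinset_graphOf {T : Finset (Sym2 V)} (hT : ∀ e ∈ T, ¬ e.IsDiag)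
    [Fintype (graphOf T).edgeSet] : (graphOf T).edgeFinset = T := by
  ext e
  simp only [SimpleGraph.mem_edgeFinset, SimpleGraph.edgeSet_fromEdgeSet, Set.mem_sdiff, mem_coe,
    Sym2.mem_diagSet, and_iff_left_iff_imp]
  exact hT e

lemma card_add_one_of_mem_spanningTrees {T : Finset (Sym2 V)}
    (hT : T ∈ spanningTrees (⊤ : SimpleGraph V)) : T.card + 1 = Fintype.card V := by
  classical
  rw [mem_spanningTrees_top] at hT
  rw [← hT.2.card_edgeFinset, edgeFinset_graphOf hT.1]

/-- An acyclic edge set with `|V| - 1` edges is a spanning tree. -/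
lemma mem_spanningTrees_of_isAcyclic [Nonempty V] {T : Finset (Sym2 V)}
    (hd : ∀ e ∈ T, ¬ e.IsDiag) (ha : (graphOf T).IsAcyclic) (hc : T.card + 1 = Fintype.card V) :
    T ∈ spanningTrees (⊤ : SimpleGraph V) := by
  classical
  rw [mem_spanningTrees_top]
  refine ⟨hd, ?_⟩
  obtain ⟨F, hTF, -, hF⟩ :=
    (SimpleGraph.connected_top (V := V)).exists_isTree_le_of_le_of_isAcyclic le_top ha
  have hcard := hF.card_edgeFinset
  have hsub : T ⊆ F.edgeFinset := by
    have := SimpleGraph.edgeFinset_mono hTF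
    rwa [edgeFinset_graphOf hd] at this
  have heq : T = F.edgeFinset := eq_of_subset_of_card_le hsub (by omega)
  have : graphOf T = F := by
    rw [graphOf, heq, SimpleGraph.coe_edgeFinset, SimpleGraph.fromEdgeSet_edgeSet]
  rwa [this]

lemma graphOf_insert (F : Finset (Sym2 V)) (x y : V) :
    graphOf (insert s(x, y) F) = graphOf F ⊔ SimpleGraph.edge x y := by
  rw [graphOf, coe_insert, Set.insert_eq, Set.union_comm, SimpleGraph.fromEdgeSet_union]
  rfl

lemma graphOf_mono {F F' : Finset (Sym2 V)} (h : F ⊆ F') : graphOf F ≤ graphOf F' :=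
  SimpleGraph.fromEdgeSet_mono (by exact_mod_cast h)

lemma reachable_of_mem {F : Finset (Sym2 V)} {x y : V} (h : s(x, y) ∈ F) :
    (graphOf F).Reachable x y := by
  by_cases hxy : x = y
  · subst hxy; rfl
  · exact SimpleGraph.Adj.reachable (by simp [h, hxy])

/-- Exchange property for spanning trees. -/
lemma insert_erase_mem_spanningTrees [Nonempty V] {T : Finset (Sym2 V)}
    (hT : T ∈ spanningTrees (⊤ : SimpleGraph V)) {e : Sym2 V} (he : e ∈ T) {x y : V}
    (hxy : ¬ (graphOf (T.erase e)).Reachable x y) :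
    insert s(x, y) (T.erase e) ∈ spanningTrees (⊤ : SimpleGraph V) := by
  have hc := card_add_one_of_mem_spanningTrees hT
  rw [mem_spanningTrees_top] at hT
  have hne : x ≠ y := by rintro rfl; exact hxy (by rfl)
  apply mem_spanningTrees_of_isAcyclic
  · intro f hf
    rcases mem_insert.1 hf with rfl | hf
    · simpa using hne
    · exact hT.1 f (mem_of_mem_erase hf)
  · rw [graphOf_insert]
    exact (hT.2.isAcyclic.anti (graphOf_mono (erase_subset _ _))).sup_edge_of_not_reachable hxy
  · rw [card_insert_of_notMem (fun h => hxy (reachable_of_mem h)), card_erase_of_mem he]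
    have := card_pos.2 ⟨e, he⟩
    omega

/-- Removing an edge of a spanning tree separates its endpoints. -/
lemma not_reachable_erase {T : Finset (Sym2 V)}
    (hT : T ∈ spanningTrees (⊤ : SimpleGraph V)) {x y : V} (h : s(x, y) ∈ T) :
    ¬ (graphOf (T.erase s(x, y))).Reachable x y := by
  rw [mem_spanningTrees_top] at hT
  have hne : x ≠ y := by simpa using hT.1 _ h
  have := SimpleGraph.isAcyclic_iff_forall_isBridge.1 hT.2.isAcyclic
    (e := s(x, y)) (by simp [h, hne])
  rw [SimpleGraph.isBridge_iff] at this
  convert this using 2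
  rw [graphOf, coe_erase, SimpleGraph.fromEdgeSet_sdiff]
  rfl

open scoped Classical in
/-- Signed indicator of the component of `a` against that of `b` in the graph of `F`. -/
def sepFun (F : Finset (Sym2 V)) (a b x : V) : ℝ :=
  (if (graphOf F).Reachable a x then 1 else 0) - (if (graphOf F).Reachable b x then 1 else 0)

/-- Difference of `f` along an (arbitrarily oriented) edge. -/
def edgeDiff (f : V → ℝ) (g : Sym2 V) : ℝ := f (Quot.out g).1 - f (Quot.out g).2

lemma sepFun_of_reachable {F : Finset (Sym2 V)} {a b : V} (h : (graphOf F).Reachable a b) :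
    sepFun F a b = 0 := by
  ext x
  have : (graphOf F).Reachable a x ↔ (graphOf F).Reachable b x :=
    ⟨fun h' => h.symm.trans h', fun h' => h.trans h'⟩
  simp [sepFun, this]

lemma sepFun_congr {F : Finset (Sym2 V)} {a b x y : V} (h : (graphOf F).Reachable x y) :
    sepFun F a b x = sepFun F a b y := by
  have (c : V) : (graphOf F).Reachable c x ↔ (graphOf F).Reachable c y :=
    ⟨fun h' => h'.trans h, fun h' => h'.trans h.symm⟩
  simp [sepFun, this]

lemma sepFun_left {F : Finset (Sym2 V)} {a b : V} (h : ¬ (graphOf F).Reachable a b) :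
    sepFun F a b a = 1 := by
  have : ¬ (graphOf F).Reachable b a := fun h' => h h'.symm
  simp [sepFun, this]

lemma sepFun_right {F : Finset (Sym2 V)} {a b : V} (h : ¬ (graphOf F).Reachable a b) :
    sepFun F a b b = -1 := by
  simp [sepFun, h]

lemma mk_out (g : Sym2 V) : s((Quot.out g).1, (Quot.out g).2) = g := Quot.out_eq g

lemma edgeDiff_mul_mk (f f' : V → ℝ) (x y : V) :
    edgeDiff f s(x, y) * edgeDiff f' s(x, y) = (f x - f y) * (f' x - f' y) := by
  have h := mk_out s(x, y)
  rw [Sym2.eq_iff] at h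
  rcases h with ⟨h1, h2⟩ | ⟨h1, h2⟩ <;> simp only [edgeDiff, h1, h2]
  ring

lemma sum_edgeDiff_sepFun_of_mem {T : Finset (Sym2 V)}
    (hT : T ∈ spanningTrees (⊤ : SimpleGraph V)) (f : V → ℝ) {a b : V} (h : s(a, b) ∈ T) :
    ∑ g ∈ T, edgeDiff (sepFun (T.erase g) a b) g * edgeDiff f g = 2 * (f a - f b) := by
  rw [sum_eq_single_of_mem _ h]
  · rw [edgeDiff_mul_mk, sepFun_left (not_reachable_erase hT h),
      sepFun_right (not_reachable_erase hT h)]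
    ring
  · intro g _ hg
    rw [sepFun_of_reachable (reachable_of_mem (mem_erase.2 ⟨hg.symm, h⟩))]
    simp [edgeDiff]

lemma sum_edgeDiff_sepFun {T : Finset (Sym2 V)}
    (hT : T ∈ spanningTrees (⊤ : SimpleGraph V)) (f : V → ℝ) (a b : V) :
    ∑ g ∈ T, edgeDiff (sepFun (T.erase g) a b) g * edgeDiff f g = 2 * (f a - f b) := by
  obtain ⟨w⟩ := (mem_spanningTrees_top.1 hT).2.connected.preconnected a b
  induction w with
  | nil => simp [sepFun_of_reachable, edgeDiff]
  | @cons a c b hac w ih =>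
    have h1 := sum_edgeDiff_sepFun_of_mem hT f (a := a) (b := c) (by
      have := (SimpleGraph.fromEdgeSet_adj _).1 hac
      exact_mod_cast this.1)
    have : ∑ g ∈ T, edgeDiff (sepFun (T.erase g) a b) g * edgeDiff f g =
        ∑ g ∈ T, edgeDiff (sepFun (T.erase g) a c) g * edgeDiff f g +
        ∑ g ∈ T, edgeDiff (sepFun (T.erase g) c b) g * edgeDiff f g := by
      rw [← sum_add_distrib]
      refine sum_congr rfl fun g _ => ?_
      simp only [edgeDiff, sepFun]
      ring
    rw [this, h1, ih]
    ring

/-- Total weight of the spanning trees through `e`, with the factor of `e` removed. -/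
def contractZ (e : Sym2 V) (c : Sym2 V → ℝ) : ℝ :=
  ∑ T ∈ spanningTrees (⊤ : SimpleGraph V) with e ∈ T, treeWeight c (T.erase e)

/-- Total weight of the spanning trees avoiding `e`. -/
def deleteZ (e : Sym2 V) (c : Sym2 V → ℝ) : ℝ :=
  ∑ T ∈ spanningTrees (⊤ : SimpleGraph V) with e ∉ T, treeWeight c T

/-- Dirichlet form of the complete graph with the edge `e` removed. -/
def energy (e : Sym2 V) (c : Sym2 V → ℝ) (f f' : V → ℝ) : ℝ :=
  ∑ g ∈ univ.erase e, c g * (edgeDiff f g * edgeDiff f' g)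

/-- Kirchhoff's potential: a multiple of the unit current flow from `a` to `b` in the
complete graph with the edge `ab` removed. -/
def potential (a b : V) (c : Sym2 V → ℝ) (x : V) : ℝ :=
  ∑ T ∈ spanningTrees (⊤ : SimpleGraph V) with s(a, b) ∈ T,
    treeWeight c (T.erase s(a, b)) * sepFun (T.erase s(a, b)) a b x

lemma potential_sub (a b : V) (c : Sym2 V → ℝ) :
    potential a b c a - potential a b c b = 2 * contractZ s(a, b) c := by
  rw [potential, potential, contractZ, ← sum_sub_distrib, mul_sum]
  refine sum_congr rfl fun T hT => ?_
  rw [mem_filter] at hT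
  rw [sepFun_left (not_reachable_erase hT.1 hT.2), sepFun_right (not_reachable_erase hT.1 hT.2)]
  ring

lemma edgeDiff_potential (a b : V) (c : Sym2 V → ℝ) (g : Sym2 V) :
    edgeDiff (potential a b c) g = ∑ T ∈ spanningTrees (⊤ : SimpleGraph V) with s(a, b) ∈ T,
      treeWeight c (T.erase s(a, b)) * edgeDiff (sepFun (T.erase s(a, b)) a b) g := by
  simp only [edgeDiff, potential, ← sum_sub_distrib, mul_sub]

lemma not_reachable_of_edgeDiff_sepFun_ne {F : Finset (Sym2 V)} {a b : V} {g : Sym2 V}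
    (h : edgeDiff (sepFun F a b) g ≠ 0) :
    ¬ (graphOf F).Reachable (Quot.out g).1 (Quot.out g).2 ∧ ¬ (graphOf F).Reachable a b := by
  refine ⟨fun h' => h ?_, fun h' => h ?_⟩
  · rw [edgeDiff, sepFun_congr h', sub_self]
  · rw [sepFun_of_reachable h']
    simp [edgeDiff]

lemma energy_potential [Nonempty V] (a b : V) (c : Sym2 V → ℝ) (f : V → ℝ) :
    energy s(a, b) c (potential a b c) f = 2 * deleteZ s(a, b) c * (f a - f b) := by
  set e := s(a, b) with he
  have hL : energy e c (potential a b c) f =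
      ∑ p ∈ univ.erase e ×ˢ (spanningTrees (⊤ : SimpleGraph V)).filter (e ∈ ·),
        c p.1 * treeWeight c (p.2.erase e) *
          (edgeDiff (sepFun (p.2.erase e) a b) p.1 * edgeDiff f p.1) := by
    rw [energy, sum_product]
    refine sum_congr rfl fun g _ => ?_
    rw [edgeDiff_potential, sum_mul, mul_sum]
    refine sum_congr rfl fun T _ => ?_
    ring
  have hR : 2 * deleteZ e c * (f a - f b) =
      ∑ p ∈ ((spanningTrees (⊤ : SimpleGraph V)).filter (e ∉ ·)).sigma fun T => T,
        treeWeight c p.1 *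
          (edgeDiff (sepFun (p.1.erase p.2) a b) p.2 * edgeDiff f p.2) := by
    rw [sum_sigma, deleteZ, mul_sum, sum_mul]
    refine sum_congr rfl fun T hT => ?_
    simp only [← mul_sum, sum_edgeDiff_sepFun (mem_filter.1 hT).1]
    ring
  rw [hL, hR]
  refine sum_bij_ne_zero (fun p _ _ => ⟨insert p.1 (p.2.erase e), p.1⟩) ?_ ?_ ?_ ?_
  · rintro ⟨g, T⟩ hp hne
    simp only [mem_product, mem_erase, mem_univ, and_true, mem_filter] at hp
    obtain ⟨hge, hT, heT⟩ := hp
    have hd := not_reachable_of_edgeDiff_sepFun_ne (left_ne_zero_of_mul (right_ne_zero_of_mul hne))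
    have := insert_erase_mem_spanningTrees hT heT hd.1
    rw [mk_out] at this
    simp [this, hge.symm]
  · rintro ⟨g, T⟩ hp hne ⟨g', T'⟩ hp' hne' heq
    simp only [mem_product, mem_erase, mem_univ, and_true, mem_filter] at hp hp'
    have hd := not_reachable_of_edgeDiff_sepFun_ne (left_ne_zero_of_mul (right_ne_zero_of_mul hne))
    have hd' := not_reachable_of_edgeDiff_sepFun_ne
      (left_ne_zero_of_mul (right_ne_zero_of_mul hne'))
    simp only [Sigma.mk.injEq, heq_eq_eq] at heq
    obtain ⟨h1, rfl⟩ := heq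
    have hg : g ∉ T.erase e := fun h => hd.1 (reachable_of_mem (by rwa [mk_out]))
    have hg' : g ∉ T'.erase e := fun h => hd'.1 (reachable_of_mem (by rwa [mk_out]))
    have h2 : T.erase e = T'.erase e := by
      rw [← erase_insert hg, h1, erase_insert hg']
    have h3 : T = T' := by
      rw [← insert_erase hp.2.2, h2, insert_erase hp'.2.2]
    rw [h3]
  · rintro ⟨T, g⟩ hp hne
    simp only [mem_sigma, mem_filter] at hp
    obtain ⟨⟨hT, heT⟩, hg⟩ := hp
    have hd := not_reachable_of_edgeDiff_sepFun_ne (left_ne_zero_of_mul (right_ne_zero_of_mul hne))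
    have hT' := insert_erase_mem_spanningTrees hT hg hd.2
    have heT' : e ∉ T.erase g := fun h => heT (mem_of_mem_erase h)
    have hge : g ≠ e := fun h => heT (h ▸ hg)
    have hT2 : (insert e (T.erase g)).erase e = T.erase g := erase_insert heT'
    refine ⟨(g, insert e (T.erase g)), ?_, ?_, ?_⟩
    · simp [hge, show insert e (T.erase g) ∈ spanningTrees (⊤ : SimpleGraph V) from hT']
    · simp only [hT2]
      have : c g * treeWeight c (T.erase g) = treeWeight c T := mul_prod_erase T c hg
      rwa [this]
    · simp only [hT2, insert_erase hg]
  · rintro ⟨g, T⟩ hp hne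
    have hd := not_reachable_of_edgeDiff_sepFun_ne (left_ne_zero_of_mul (right_ne_zero_of_mul hne))
    have hg : g ∉ T.erase e := fun h => hd.1 (reachable_of_mem (by rwa [mk_out]))
    simp only [erase_insert hg]
    rw [treeWeight, treeWeight, prod_insert hg]

lemma treeWeight_mono {c c' : Sym2 V → ℝ} (hc : ∀ e, 0 < c e) (hcc : ∀ e, c e ≤ c' e)
    (T : Finset (Sym2 V)) : treeWeight c T ≤ treeWeight c' T :=
  prod_le_prod (fun e _ => (hc e).le) fun e _ => hcc e

lemma treeWeight_pos {c : Sym2 V → ℝ} (hc : ∀ e, 0 < c e) (T : Finset (Sym2 V)) :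
    0 < treeWeight c T := prod_pos fun e _ => hc e

lemma contractZ_nonneg {c : Sym2 V → ℝ} (hc : ∀ e, 0 < c e) (e : Sym2 V) : 0 ≤ contractZ e c :=
  sum_nonneg fun _ _ => (treeWeight_pos hc _).le

lemma deleteZ_nonneg {c : Sym2 V → ℝ} (hc : ∀ e, 0 < c e) (e : Sym2 V) : 0 ≤ deleteZ e c :=
  sum_nonneg fun _ _ => (treeWeight_pos hc _).le

/-- Rayleigh monotonicity in terms of spanning trees. -/
lemma contractZ_mul_deleteZ_le [Nonempty V] {c c' : Sym2 V → ℝ} (hc : ∀ e, 0 < c e)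
    (hcc : ∀ e, c e ≤ c' e) (e : Sym2 V) :
    contractZ e c' * deleteZ e c ≤ contractZ e c * deleteZ e c' := by
  induction e with | _ a b =>
  have hc' e : 0 < c' e := (hc e).trans_le (hcc e)
  have hB := deleteZ_nonneg hc s(a, b)
  have hB' : deleteZ s(a, b) c ≤ deleteZ s(a, b) c' :=
    sum_le_sum fun T _ => treeWeight_mono hc hcc T
  have hA := contractZ_nonneg hc s(a, b)
  rcases hB.eq_or_lt with h0 | hpos
  · rw [← h0, mul_zero]
    exact mul_nonneg hA (deleteZ_nonneg hc' _)
  set A := contractZ s(a, b) c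
  set B := deleteZ s(a, b) c
  set A' := contractZ s(a, b) c'
  set B' := deleteZ s(a, b) c'
  have e11 := energy_potential a b c (potential a b c)
  have e12 := energy_potential a b c (potential a b c')
  have e22 := energy_potential a b c' (potential a b c')
  rw [potential_sub] at e11 e12 e22
  have hle : energy s(a, b) c (potential a b c') (potential a b c') ≤
      energy s(a, b) c' (potential a b c') (potential a b c') :=
    sum_le_sum fun g _ => mul_le_mul_of_nonneg_right (hcc g) (mul_self_nonneg _)
  have hsq : 0 ≤ B' ^ 2 * energy s(a, b) c (potential a b c) (potential a b c) -
      2 * B * B' * energy s(a, b) c (potential a b c) (potential a b c') +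
      B ^ 2 * energy s(a, b) c (potential a b c') (potential a b c') := by
    simp only [energy, mul_sum, ← sum_sub_distrib, ← sum_add_distrib]
    refine sum_nonneg fun g _ => ?_
    have := mul_nonneg (hc g).le (sq_nonneg (B' * edgeDiff (potential a b c) g -
      B * edgeDiff (potential a b c') g))
    linarith
  have hpos' : 0 < B' := hpos.trans_le hB'
  rw [e11, e12] at hsq
  rw [e22] at hle
  have h4 : 0 ≤ B * B' * (A * B' - A' * B) := by nlinarith [sq_nonneg B]
  exact sub_nonneg.1 (nonneg_of_mul_nonneg_right h4 (mul_pos hpos hpos'))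

/-- The probability of `e` in the weighted spanning tree measure after its conductance is
reset to one. -/
def normProb (e : Sym2 V) (c : Sym2 V → ℝ) : ℝ :=
  contractZ e c / (contractZ e c + deleteZ e c)

/-- The probability of `e` in the weighted spanning tree measure. -/
def edgeProb (e : Sym2 V) (c : Sym2 V → ℝ) : ℝ :=
  c e * contractZ e c / partZ (⊤ : SimpleGraph V) c

lemma treeWeight_sum_mem (e : Sym2 V) (c : Sym2 V → ℝ) :
    ∑ T ∈ spanningTrees (⊤ : SimpleGraph V) with e ∈ T, treeWeight c T = c e * contractZ e c := by
  rw [contractZ, mul_sum]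
  exact sum_congr rfl fun T hT => (mul_prod_erase T c (mem_filter.1 hT).2).symm

lemma partZ_eq (e : Sym2 V) (c : Sym2 V → ℝ) :
    partZ (⊤ : SimpleGraph V) c = c e * contractZ e c + deleteZ e c := by
  rw [partZ, ← treeWeight_sum_mem, deleteZ, sum_filter_add_sum_filter_not]

lemma spanningTrees_top_nonempty [Nonempty V] : (spanningTrees (⊤ : SimpleGraph V)).Nonempty := by
  classical
  obtain ⟨F, -, hF⟩ := (SimpleGraph.connected_top (V := V)).exists_isTree_le
  refine ⟨F.edgeFinset, mem_spanningTrees_top.2 ⟨fun e he => ?_, ?_⟩⟩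
  · exact F.not_isDiag_of_mem_edgeSet (SimpleGraph.mem_edgeFinset.1 he)
  · rwa [graphOf, SimpleGraph.coe_edgeFinset, SimpleGraph.fromEdgeSet_edgeSet]

lemma partZ_pos [Nonempty V] {c : Sym2 V → ℝ} (hc : ∀ e, 0 < c e) :
    0 < partZ (⊤ : SimpleGraph V) c :=
  sum_pos (fun _ _ => treeWeight_pos hc _) spanningTrees_top_nonempty

lemma contractZ_congr {e : Sym2 V} {c c' : Sym2 V → ℝ} (h : ∀ f ≠ e, c f = c' f) :
    contractZ e c = contractZ e c' :=
  sum_congr rfl fun _ _ => prod_congr rfl fun f hf => h f (ne_of_mem_erase hf)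

lemma deleteZ_congr {e : Sym2 V} {c c' : Sym2 V → ℝ} (h : ∀ f ≠ e, c f = c' f) :
    deleteZ e c = deleteZ e c' :=
  sum_congr rfl fun _ hT => prod_congr rfl fun f hf =>
    h f fun hfe => (mem_filter.1 hT).2 (hfe ▸ hf)

lemma normProb_congr {e : Sym2 V} {c c' : Sym2 V → ℝ} (h : ∀ f ≠ e, c f = c' f) :
    normProb e c = normProb e c' := by
  rw [normProb, normProb, contractZ_congr h, deleteZ_congr h]

lemma contractZ_add_deleteZ_pos [Nonempty V] {c : Sym2 V → ℝ} (hc : ∀ e, 0 < c e) (e : Sym2 V) :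
    0 < contractZ e c + deleteZ e c := by
  have h1 := contractZ_nonneg hc e
  have h2 := deleteZ_nonneg hc e
  refine (add_nonneg h1 h2).lt_of_ne fun h => ?_
  have h3 := partZ_pos hc
  rw [partZ_eq e] at h3
  have : contractZ e c = 0 := by linarith
  rw [this] at h3
  linarith

lemma normProb_nonneg {c : Sym2 V → ℝ} (hc : ∀ e, 0 < c e) (e : Sym2 V) : 0 ≤ normProb e c :=
  div_nonneg (contractZ_nonneg hc e) (add_nonneg (contractZ_nonneg hc e) (deleteZ_nonneg hc e))

lemma normProb_le_one {c : Sym2 V → ℝ} (hc : ∀ e, 0 < c e) (e : Sym2 V) : normProb e c ≤ 1 :=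
  div_le_one_of_le₀ (by linarith [deleteZ_nonneg hc e])
    (add_nonneg (contractZ_nonneg hc e) (deleteZ_nonneg hc e))

lemma normProb_anti [Nonempty V] {c c' : Sym2 V → ℝ} (hc : ∀ e, 0 < c e)
    (hcc : ∀ e, c e ≤ c' e) (e : Sym2 V) : normProb e c' ≤ normProb e c := by
  have hc' e : 0 < c' e := (hc e).trans_le (hcc e)
  rw [normProb, normProb, div_le_div_iff₀ (contractZ_add_deleteZ_pos hc' e)
    (contractZ_add_deleteZ_pos hc e)]
  linarith [contractZ_mul_deleteZ_le hc hcc e]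

lemma edgeProb_nonneg [Nonempty V] {c : Sym2 V → ℝ} (hc : ∀ e, 0 < c e) (e : Sym2 V) :
    0 ≤ edgeProb e c :=
  div_nonneg (mul_nonneg (hc e).le (contractZ_nonneg hc e)) (partZ_pos hc).le

lemma edgeProb_le_one [Nonempty V] {c : Sym2 V → ℝ} (hc : ∀ e, 0 < c e) (e : Sym2 V) :
    edgeProb e c ≤ 1 := by
  rw [edgeProb, div_le_one (partZ_pos hc), partZ_eq e]
  linarith [deleteZ_nonneg hc e]

lemma mul_normProb_le_edgeProb [Nonempty V] {c : Sym2 V → ℝ} (hc : ∀ e, 0 < c e) {e : Sym2 V}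
    (h1 : c e ≤ 1) : c e * normProb e c ≤ edgeProb e c := by
  have hA := contractZ_nonneg hc e
  rw [normProb, edgeProb, ← mul_div_assoc]
  refine div_le_div_of_nonneg_left (mul_nonneg (hc e).le hA) (partZ_pos hc) ?_
  rw [partZ_eq e]
  nlinarith

lemma edgeProb_mul_le [Nonempty V] {c : Sym2 V → ℝ} (hc : ∀ e, 0 < c e) (e : Sym2 V) :
    edgeProb e c * (1 - normProb e c) ≤ c e * normProb e c := by
  have hA := contractZ_nonneg hc e
  have hB := deleteZ_nonneg hc e
  have hAB := contractZ_add_deleteZ_pos hc e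
  have hZ := partZ_pos hc
  have h1 : 1 - normProb e c = deleteZ e c / (contractZ e c + deleteZ e c) := by
    rw [normProb]; field_simp; ring
  rw [h1, normProb, edgeProb, div_mul_div_comm, ← mul_div_assoc, div_le_div_iff₀
    (mul_pos hZ hAB) hAB]
  have h2 : deleteZ e c ≤ partZ (⊤ : SimpleGraph V) c := by
    rw [partZ_eq e]; linarith [mul_nonneg (hc e).le hA]
  nlinarith [mul_le_mul_of_nonneg_left h2 (mul_nonneg (mul_nonneg (hc e).le hA) hAB.le)]

open scoped Classical in
lemma sum_treeWeight_mul (c u : Sym2 V → ℝ) :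
    (∑ T ∈ spanningTrees (⊤ : SimpleGraph V), treeWeight c T * ∑ e ∈ T, u e) /
      partZ (⊤ : SimpleGraph V) c =
    ∑ e ∈ (⊤ : SimpleGraph V).edgeFinset, u e * edgeProb e c := by
  have hT : ∀ T ∈ spanningTrees (⊤ : SimpleGraph V), treeWeight c T * ∑ e ∈ T, u e =
      ∑ e ∈ (⊤ : SimpleGraph V).edgeFinset, if e ∈ T then u e * treeWeight c T else 0 := by
    intro T hT
    rw [← sum_filter, mul_comm, sum_mul]
    refine sum_congr ?_ fun _ _ => rfl
    ext e
    simp only [mem_filter, SimpleGraph.mem_edgeFinset]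
    refine ⟨fun h => ⟨?_, h⟩, fun h => h.2⟩
    rw [spanningTrees, mem_filter_univ] at hT
    exact hT.1 (by exact_mod_cast h)
  rw [sum_congr rfl hT, sum_comm, sum_div]
  refine sum_congr rfl fun e _ => ?_
  rw [← sum_filter, ← mul_sum, treeWeight_sum_mem, edgeProb, mul_div_assoc]

open scoped Classical in
lemma sum_edgeProb [Nonempty V] {c : Sym2 V → ℝ} (hc : ∀ e, 0 < c e) :
    ∑ e ∈ (⊤ : SimpleGraph V).edgeFinset, edgeProb e c = Fintype.card V - 1 := by
  have h := sum_treeWeight_mul c (fun _ => 1)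
  simp only [one_mul] at h
  rw [← h, div_eq_iff (partZ_pos hc).ne', partZ, mul_sum]
  refine sum_congr rfl fun T hT => ?_
  rw [← card_add_one_of_mem_spanningTrees hT]
  simp [mul_comm]

/-- The action of a permutation of the vertices on edges. -/
def edgePerm (σ : Equiv.Perm V) : Equiv.Perm (Sym2 V) where
  toFun := Sym2.map σ
  invFun := Sym2.map σ.symm
  left_inv e := by simp [Sym2.map_map]
  right_inv e := by simp [Sym2.map_map]

lemma edgePerm_mk (σ : Equiv.Perm V) (x y : V) : edgePerm σ s(x, y) = s(σ x, σ y) := rfl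

lemma map_edgePerm_mem_spanningTrees (σ : Equiv.Perm V) (T : Finset (Sym2 V)) :
    T.map (edgePerm σ).toEmbedding ∈ spanningTrees (⊤ : SimpleGraph V) ↔
      T ∈ spanningTrees (⊤ : SimpleGraph V) := by
  have hadj (x y : V) : s(σ x, σ y) ∈ T.map (edgePerm σ).toEmbedding ↔ s(x, y) ∈ T :=
    mem_map' (edgePerm σ).toEmbedding (a := s(x, y))
  have iso : graphOf T ≃g graphOf (T.map (edgePerm σ).toEmbedding) :=
    ⟨σ, by
      intro x y
      rw [SimpleGraph.fromEdgeSet_adj, SimpleGraph.fromEdgeSet_adj, mem_coe, mem_coe, hadj]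
      simp⟩
  rw [mem_spanningTrees_top, mem_spanningTrees_top, iso.isTree_iff]
  refine and_congr_left fun _ => ?_
  rw [Finset.forall_mem_map]
  refine forall₂_congr fun e _ => ?_
  induction e with | _ x y => simp [edgePerm_mk]

lemma treeWeight_map (σ : Equiv.Perm V) (c : Sym2 V → ℝ) (T : Finset (Sym2 V)) :
    treeWeight c (T.map (edgePerm σ).toEmbedding) = treeWeight (c ∘ edgePerm σ) T := by
  simp [treeWeight]

lemma edgeProb_comp_edgePerm (σ : Equiv.Perm V) (c : Sym2 V → ℝ) (e : Sym2 V) :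
    edgeProb e (c ∘ edgePerm σ) = edgeProb (edgePerm σ e) c := by
  rw [edgeProb, edgeProb, ← treeWeight_sum_mem, ← treeWeight_sum_mem]
  congr 1
  · refine sum_equiv (edgePerm σ).finsetCongr (fun T => ?_) fun T _ => ?_
    · simp only [mem_filter, Equiv.finsetCongr_apply, map_edgePerm_mem_spanningTrees]
      rw [← Equiv.coe_toEmbedding, Finset.mem_map']
    · rw [Equiv.finsetCongr_apply, treeWeight_map]
  · refine sum_equiv (edgePerm σ).finsetCongr (fun T => ?_) fun T _ => ?_
    · rw [Equiv.finsetCongr_apply, map_edgePerm_mem_spanningTrees]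
    · rw [Equiv.finsetCongr_apply, treeWeight_map]

lemma exists_edgePerm_eq {e f : Sym2 V} (he : ¬ e.IsDiag) (hf : ¬ f.IsDiag) :
    ∃ σ : Equiv.Perm V, edgePerm σ e = f := by
  induction e with | _ a b =>
  induction f with | _ x y =>
  rw [Sym2.mk_isDiag_iff] at he hf
  refine ⟨(Equiv.swap a x).trans (Equiv.swap (Equiv.swap a x b) y), ?_⟩
  have h1 : x ≠ Equiv.swap a x b := by
    intro h
    apply he
    have := congrArg (Equiv.swap a x) h
    simpa using this
  simp [edgePerm_mk, Equiv.swap_apply_of_ne_of_ne h1 hf]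

/-- The uniform distribution on the unit interval. -/
abbrev unitLaw : Measure ℝ := volume.restrict (Set.Icc (0 : ℝ) 1)

instance : IsProbabilityMeasure unitLaw := ⟨by simp⟩

instance (ι : Type) [Fintype ι] : IsProbabilityMeasure (labelMeasure ι) := by
  unfold labelMeasure; infer_instance

lemma ae_mem_Icc (ι : Type) [Fintype ι] :
    ∀ᵐ u ∂labelMeasure ι, ∀ i, u i ∈ Set.Icc (0 : ℝ) 1 := by
  rw [ae_all_iff]
  intro i
  exact (Measure.quasiMeasurePreserving_eval (fun _ : ι => unitLaw) i).ae
    (ae_restrict_mem measurableSet_Icc)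

lemma measurable_contractZ (e : Sym2 V) : Measurable (contractZ e) := by
  unfold contractZ treeWeight; fun_prop

lemma measurable_deleteZ (e : Sym2 V) : Measurable (deleteZ e) := by
  unfold deleteZ treeWeight; fun_prop

lemma measurable_normProb (e : Sym2 V) : Measurable (normProb e) :=
  (measurable_contractZ e).div ((measurable_contractZ e).add (measurable_deleteZ e))

lemma measurable_edgeProb (e : Sym2 V) : Measurable (edgeProb e) := by
  have : Measurable (partZ (⊤ : SimpleGraph V)) := by
    unfold partZ treeWeight; fun_prop
  exact ((measurable_pi_apply e).mul (measurable_contractZ e)).div this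

lemma integral_comp_perm {ι : Type} [Fintype ι] (π : Equiv.Perm ι) (f : (ι → ℝ) → ℝ) :
    ∫ u, f (u ∘ π) ∂labelMeasure ι = ∫ u, f u ∂labelMeasure ι := by
  have h := (measurePreserving_piCongrLeft (fun _ : ι => unitLaw) π.symm).integral_comp' f
  rw [labelMeasure, ← h]
  refine integral_congr_ae (ae_of_all _ fun u => ?_)
  refine congrArg f (funext fun i => ?_)
  have := MeasurableEquiv.piCongrLeft_apply_apply (π.symm) (β := fun _ : ι => ℝ) u (π i)
  simpa using this.symm

lemma integral_edgeProb_eq {κ : ℝ → ℝ} {e f : Sym2 V} (he : ¬ e.IsDiag) (hf : ¬ f.IsDiag) :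
    ∫ u, edgeProb e (κ ∘ u) ∂labelMeasure (Sym2 V) =
      ∫ u, edgeProb f (κ ∘ u) ∂labelMeasure (Sym2 V) := by
  obtain ⟨σ, rfl⟩ := exists_edgePerm_eq he hf
  rw [← integral_comp_perm (edgePerm σ)]
  simp only [← edgeProb_comp_edgePerm]
  rfl

lemma integrable_of_bound {ι : Type} [Fintype ι] {f : (ι → ℝ) → ℝ} (hf : Measurable f) (C : ℝ)
    (h : ∀ u, (∀ i, u i ∈ Set.Icc (0 : ℝ) 1) → |f u| ≤ C) : Integrable f (labelMeasure ι) := by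
  refine Integrable.of_bound hf.aestronglyMeasurable C ?_
  filter_upwards [ae_mem_Icc ι] with u hu using h u hu

lemma integral_edgeProb [Nontrivial V] {κ : ℝ → ℝ} (hκ : Measurable κ) (hpos : ∀ x, 0 < κ x)
    {e : Sym2 V} (he : ¬ e.IsDiag) :
    ∫ u, edgeProb e (κ ∘ u) ∂labelMeasure (Sym2 V) = 2 / Fintype.card V := by
  classical
  have hpos' (u : Sym2 V → ℝ) (f : Sym2 V) : 0 < (κ ∘ u) f := hpos _
  have hint (f : Sym2 V) : Integrable (fun u => edgeProb f (κ ∘ u)) (labelMeasure (Sym2 V)) := by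
    refine integrable_of_bound ((measurable_edgeProb f).comp (by fun_prop)) 1 fun u _ => ?_
    rw [abs_of_nonneg (edgeProb_nonneg (hpos' u) f)]
    exact edgeProb_le_one (hpos' u) f
  have h1 : ∑ f ∈ (⊤ : SimpleGraph V).edgeFinset,
      ∫ u, edgeProb f (κ ∘ u) ∂labelMeasure (Sym2 V) = Fintype.card V - 1 := by
    rw [← integral_finsetSum _ fun f _ => hint f]
    have h (u : Sym2 V → ℝ) : ∑ f ∈ (⊤ : SimpleGraph V).edgeFinset, edgeProb f (κ ∘ u) =
        Fintype.card V - 1 := by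
      rw [← sum_edgeProb (hpos' u)]
    rw [integral_congr_ae (ae_of_all _ h)]
    simp only [integral_const, probReal_univ, one_smul]
  rw [sum_congr rfl fun f hf => integral_edgeProb_eq (κ := κ)
    ((⊤ : SimpleGraph V).not_isDiag_of_mem_edgeSet (SimpleGraph.mem_edgeFinset.1 hf)) he,
    sum_const, SimpleGraph.card_edgeFinset_top_eq_card_choose_two, nsmul_eq_mul,
    Nat.cast_choose_two] at h1
  have hc : (1 : ℝ) < Fintype.card V := by exact_mod_cast Fintype.one_lt_card
  have hc' : (Fintype.card V : ℝ) - 1 ≠ 0 := by linarith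
  rw [eq_div_iff (by positivity)]
  apply mul_left_cancel₀ hc'
  linarith

lemma integral_mul_of_indep {ι : Type} [Fintype ι] [DecidableEq ι] (i : ι) {φ : ℝ → ℝ}
    (hφ : Measurable φ) {q : (ι → ℝ) → ℝ} (hq : Measurable q)
    (hqi : ∀ u u', (∀ j ≠ i, u j = u' j) → q u = q u') :
    ∫ u, φ (u i) * q u ∂labelMeasure ι =
      (∫ x, φ x ∂unitLaw) * ∫ u, q u ∂labelMeasure ι := by
  have hind := (ProbabilityTheory.iIndepFun_pi (μ := fun _ : ι => unitLaw)
    (X := fun _ => id) (fun _ => aemeasurable_id)).indepFun_finset {i} (univ.erase i)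
    (by simp) (fun j => by simpa using measurable_pi_apply j)
  let fill : (↥(univ.erase i) → ℝ) → ι → ℝ :=
    fun v j => if h : j ∈ univ.erase i then v ⟨j, h⟩ else 0
  have hfill : Measurable fill := by
    refine measurable_pi_lambda _ fun j => ?_
    by_cases h : j ∈ univ.erase i
    · simp only [fill, dif_pos h]
      fun_prop
    · simp only [fill, dif_neg h]
      fun_prop
  have hind2 := hind.comp
    (φ := fun v : ↥({i} : Finset ι) → ℝ => φ (v ⟨i, mem_singleton_self i⟩)) (ψ := q ∘ fill)
    (by fun_prop) (hq.comp hfill)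
  have hq' (u : ι → ℝ) : q u = q (fill fun j : (univ.erase i : Finset ι) => u j) :=
    hqi _ _ fun j hj => by simp [fill, hj]
  have h := hind2.integral_fun_mul_eq_mul_integral
    (Measurable.aestronglyMeasurable (by fun_prop))
    (((hq.comp hfill).comp (by fun_prop)).aestronglyMeasurable)
  simp only [Function.comp_def, id, ← hq'] at h
  rw [labelMeasure, h]
  congr 1
  have hm := measurePreserving_eval (fun _ : ι => unitLaw) i
  conv_rhs => rw [← hm.map_eq]
  rw [integral_map hm.measurable.aemeasurable hφ.aestronglyMeasurable]

section Sandwich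

variable [Nontrivial V] {κ : ℝ → ℝ} {e : Sym2 V}

lemma integrable_normProb (hκ : Measurable κ) (hpos : ∀ x, 0 < κ x) :
    Integrable (fun u => normProb e (κ ∘ u)) (labelMeasure (Sym2 V)) := by
  refine integrable_of_bound ((measurable_normProb e).comp (by fun_prop)) 1 fun u _ => ?_
  rw [abs_of_nonneg (normProb_nonneg (c := κ ∘ u) (fun f => hpos _) e)]
  exact normProb_le_one (fun f => hpos _) e

lemma integral_mul_normProb (hκ : Measurable κ) {ψ : ℝ → ℝ} (hψ : Measurable ψ) :
    ∫ u, ψ (u e) * κ (u e) * normProb e (κ ∘ u) ∂labelMeasure (Sym2 V) =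
      (∫ x, ψ x * κ x ∂unitLaw) * ∫ u, normProb e (κ ∘ u) ∂labelMeasure (Sym2 V) :=
  integral_mul_of_indep e (φ := fun x => ψ x * κ x) (by fun_prop)
    ((measurable_normProb e).comp (by fun_prop))
    fun u u' h => normProb_congr fun f hf => congrArg κ (h f hf)

variable (hκ : Measurable κ) (hpos : ∀ x, 0 < κ x) (hle : ∀ x ∈ Set.Icc (0 : ℝ) 1, κ x ≤ 1)
  {ψ : ℝ → ℝ} (hψ : Measurable ψ) (hψ01 : ∀ x ∈ Set.Icc (0 : ℝ) 1, ψ x ∈ Set.Icc (0 : ℝ) 1)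

include hκ hpos hle hψ hψ01

lemma integrable_mul_normProb :
    Integrable (fun u => ψ (u e) * κ (u e) * normProb e (κ ∘ u)) (labelMeasure (Sym2 V)) := by
  refine integrable_of_bound (Measurable.mul (by fun_prop)
    ((measurable_normProb e).comp (by fun_prop))) 1 fun u hu => ?_
  have h1 := normProb_nonneg (c := κ ∘ u) (fun f => hpos _) e
  have h2 := normProb_le_one (c := κ ∘ u) (fun f => hpos _) e
  have h3 := hψ01 _ (hu e)
  have h4 := hpos (u e)
  have h5 := hle _ (hu e)
  rw [abs_of_nonneg (mul_nonneg (mul_nonneg h3.1 h4.le) h1)]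
  exact mul_le_one₀ (mul_le_one₀ h3.2 h4.le h5) h1 h2

lemma integrable_mul_edgeProb :
    Integrable (fun u => ψ (u e) * edgeProb e (κ ∘ u)) (labelMeasure (Sym2 V)) := by
  refine integrable_of_bound (Measurable.mul (by fun_prop)
    ((measurable_edgeProb e).comp (by fun_prop))) 1 fun u hu => ?_
  have h1 := edgeProb_nonneg (c := κ ∘ u) (fun f => hpos _) e
  have h2 := edgeProb_le_one (c := κ ∘ u) (fun f => hpos _) e
  have h3 := hψ01 _ (hu e)
  rw [abs_of_nonneg (mul_nonneg h3.1 h1)]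
  exact mul_le_one₀ h3.2 h1 h2

lemma integral_mul_normProb_le :
    (∫ x, ψ x * κ x ∂unitLaw) * ∫ u, normProb e (κ ∘ u) ∂labelMeasure (Sym2 V) ≤
      ∫ u, ψ (u e) * edgeProb e (κ ∘ u) ∂labelMeasure (Sym2 V) := by
  rw [← integral_mul_normProb hκ hψ]
  refine integral_mono_ae (integrable_mul_normProb hκ hpos hle hψ hψ01)
    (integrable_mul_edgeProb hκ hpos hle hψ hψ01) ?_
  filter_upwards [ae_mem_Icc _] with u hu
  rw [mul_assoc]
  exact mul_le_mul_of_nonneg_left (mul_normProb_le_edgeProb (fun f => hpos _) (hle _ (hu e)))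
    (hψ01 _ (hu e)).1

lemma integral_mul_edgeProb_le {ε : ℝ} (hε : ε < 1) :
    ∫ u, ψ (u e) * edgeProb e (κ ∘ u) ∂labelMeasure (Sym2 V) ≤
      (∫ x, ψ x * κ x ∂unitLaw) * (∫ u, normProb e (κ ∘ u) ∂labelMeasure (Sym2 V)) / (1 - ε) +
        (labelMeasure (Sym2 V)).real {u | ε < normProb e (κ ∘ u)} := by
  have hms : MeasurableSet {u : Sym2 V → ℝ | ε < normProb e (κ ∘ u)} :=
    measurableSet_lt measurable_const ((measurable_normProb e).comp (by fun_prop))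
  have hi1 := (integrable_mul_normProb (e := e) hκ hpos hle hψ hψ01).div_const (1 - ε)
  have hi2 : Integrable ({u : Sym2 V → ℝ | ε < normProb e (κ ∘ u)}.indicator
      (1 : (Sym2 V → ℝ) → ℝ))
      (labelMeasure (Sym2 V)) := (integrable_const _).indicator hms
  rw [← integral_mul_normProb hκ hψ, ← integral_div, ← integral_indicator_one hms, ← integral_add
    hi1 hi2]
  refine integral_mono_ae (integrable_mul_edgeProb hκ hpos hle hψ hψ01) (hi1.add hi2) ?_
  filter_upwards [ae_mem_Icc _] with u hu
  have hε' : 0 < 1 - ε := by linarith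
  have hc (f : Sym2 V) : 0 < (κ ∘ u) f := hpos _
  have h1 := normProb_nonneg hc e
  have h3 := hψ01 _ (hu e)
  have h4 := hpos (u e)
  have h6 := edgeProb_nonneg hc e
  have h0 : 0 ≤ ψ (u e) * κ (u e) * normProb e (κ ∘ u) := mul_nonneg (mul_nonneg h3.1 h4.le) h1
  by_cases hu' : ε < normProb e (κ ∘ u)
  · have : ψ (u e) * edgeProb e (κ ∘ u) ≤ 1 := mul_le_one₀ h3.2 h6 (edgeProb_le_one hc e)
    have h7 := div_nonneg h0 hε'.le
    simp only [Set.indicator, Set.mem_ofPred_eq, hu', if_true, Pi.one_apply]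
    linarith
  · simp only [Set.indicator, Set.mem_ofPred_eq, hu', if_false, add_zero]
    rw [le_div_iff₀ hε', mul_assoc, mul_assoc]
    refine mul_le_mul_of_nonneg_left ?_ h3.1
    refine le_trans (mul_le_mul_of_nonneg_left ?_ h6) (edgeProb_mul_le hc e)
    linarith

end Sandwich

section Amplification

lemma unitLaw_one_sub_pow_lt {m : ℕ} (hm : m ≠ 0) (t : ℝ) :
    unitLaw {w | t < 1 - (1 - w) ^ m} ^ m = unitLaw (Set.Ioi t) := by
  have hms : MeasurableSet {w : ℝ | t < 1 - (1 - w) ^ m} :=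
    measurableSet_lt measurable_const (by fun_prop)
  rw [Measure.restrict_apply hms, Measure.restrict_apply measurableSet_Ioi]
  rcases lt_or_ge t 0 with h0 | h0
  · have h1 : {w : ℝ | t < 1 - (1 - w) ^ m} ∩ Set.Icc 0 1 = Set.Icc 0 1 := by
      refine Set.inter_eq_right.2 fun w hw => ?_
      have : (1 - w) ^ m ≤ 1 := pow_le_one₀ (by linarith [hw.2]) (by linarith [hw.1])
      show t < 1 - (1 - w) ^ m
      linarith
    have h2 : Set.Ioi t ∩ Set.Icc (0 : ℝ) 1 = Set.Icc 0 1 :=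
      Set.inter_eq_right.2 fun w hw => h0.trans_le hw.1
    simp [h1, h2]
  rcases le_or_gt 1 t with h1 | h1
  · have h2 : {w : ℝ | t < 1 - (1 - w) ^ m} ∩ Set.Icc 0 1 = ∅ := by
      ext w
      simp only [Set.mem_inter_iff, Set.mem_ofPred_eq, Set.mem_Icc, Set.mem_empty_iff_false,
        iff_false, not_and]
      intro h _ h3
      have : 0 ≤ (1 - w) ^ m := pow_nonneg (by linarith) _
      linarith
    have h3 : Set.Ioi t ∩ Set.Icc (0 : ℝ) 1 = ∅ := by
      ext w
      simp only [Set.mem_inter_iff, Set.mem_Ioi, Set.mem_Icc, Set.mem_empty_iff_false,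
        iff_false, not_and]
      intro h _
      linarith
    simp [h2, h3, hm]
  obtain ⟨r, hr0, hr⟩ : ∃ r : ℝ, 0 ≤ r ∧ r ^ m = 1 - t :=
    ⟨(1 - t) ^ ((m : ℝ)⁻¹), Real.rpow_nonneg (by linarith) _,
      Real.rpow_inv_natCast_pow (by linarith) hm⟩
  have hr1 : r ≤ 1 := by
    by_contra! h
    have := one_lt_pow₀ h hm
    linarith
  have h2 : {w : ℝ | t < 1 - (1 - w) ^ m} ∩ Set.Icc 0 1 = Set.Ioc (1 - r) 1 := by
    ext w
    simp only [Set.mem_inter_iff, Set.mem_ofPred_eq, Set.mem_Icc, Set.mem_Ioc]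
    constructor
    · rintro ⟨h, h3, h4⟩
      refine ⟨?_, h4⟩
      have : 1 - w < r := lt_of_pow_lt_pow_left₀ m hr0 (by linarith)
      linarith
    · rintro ⟨h, h3⟩
      refine ⟨?_, by linarith, h3⟩
      have : (1 - w) ^ m < r ^ m := pow_lt_pow_left₀ (by linarith) (by linarith) hm
      linarith
  have h3 : Set.Ioi t ∩ Set.Icc (0 : ℝ) 1 = Set.Ioc t 1 := by
    ext w
    simp only [Set.mem_inter_iff, Set.mem_Ioi, Set.mem_Icc, Set.mem_Ioc]
    exact ⟨fun h => ⟨h.1, h.2.2⟩, fun h => ⟨h.1, by linarith [h.1], h.2⟩⟩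
  rw [h2, h3, Real.volume_Ioc, Real.volume_Ioc, ← ENNReal.ofReal_pow (by linarith), ← hr]
  ring_nf

/-- The coordinatewise minimum of `m` families of labels, each label being first transformed by
`w ↦ 1 - (1 - w) ^ m`. -/
def minLabel {ι : Type} (m : ℕ) (ω : Fin m → ι → ℝ) (e : ι) : ℝ := ⨅ i, (1 - (1 - ω i e) ^ m)

lemma minLabel_le {ι : Type} {m : ℕ} (ω : Fin m → ι → ℝ) (e : ι) (i : Fin m) :
    minLabel m ω e ≤ 1 - (1 - ω i e) ^ m :=
  ciInf_le (Set.finite_range _).bddBelow i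

lemma lt_minLabel_iff {ι : Type} {m : ℕ} [NeZero m] {ω : Fin m → ι → ℝ} {e : ι} {t : ℝ} :
    t < minLabel m ω e ↔ ∀ i, t < 1 - (1 - ω i e) ^ m := by
  refine ⟨fun h i => h.trans_le (minLabel_le ω e i), fun h => ?_⟩
  obtain ⟨i, hi⟩ := exists_eq_ciInf_of_finite (f := fun i => 1 - (1 - ω i e) ^ m)
  rw [minLabel, ← hi]
  exact h i

lemma measurable_minLabel {ι : Type} (m : ℕ) : Measurable (minLabel (ι := ι) m) :=
  measurable_pi_lambda _ fun e => Measurable.iInf fun i => by fun_prop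

lemma map_minLabel (ι : Type) [Fintype ι] (m : ℕ) [NeZero m] :
    (Measure.pi fun _ : Fin m => labelMeasure ι).map (minLabel m) = labelMeasure ι := by
  let S : unitLaw.FiniteSpanningSetsIn (Set.range Set.Ioi) :=
    { set := fun k => Set.Ioi (-(k : ℝ))
      set_mem := fun k => ⟨_, rfl⟩
      finite := fun k => measure_lt_top _ _
      spanning := by
        refine Set.eq_univ_of_forall fun x => ?_
        obtain ⟨k, hk⟩ := exists_nat_gt (-x)
        exact Set.mem_iUnion.2 ⟨k, by simp only [Set.mem_Ioi]; linarith⟩ }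
  refine (Measure.pi_eq_generateFrom (C := fun _ => Set.range Set.Ioi)
    (fun _ => (borel_eq_generateFrom_Ioi ℝ).symm.trans (BorelSpace.measurable_eq (α := ℝ)).symm)
    (fun _ => isPiSystem_Ioi) (fun _ => S) fun s hs => ?_).symm
  choose t ht using hs
  obtain rfl : (fun e => Set.Ioi (t e)) = s := funext ht
  rw [Measure.map_apply (measurable_minLabel m)
    (MeasurableSet.univ_pi fun _ => measurableSet_Ioi)]
  have : minLabel m ⁻¹' (Set.univ.pi fun e => Set.Ioi (t e)) = Set.univ.pi fun _ : Fin m =>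
      Set.univ.pi fun e : ι => {w : ℝ | t e < 1 - (1 - w) ^ m} := by
    ext ω
    simp only [Set.mem_preimage, Set.mem_univ_pi, Set.mem_Ioi, lt_minLabel_iff,
      Set.mem_ofPred_eq]
    exact forall_comm
  rw [this, Measure.pi_pi]
  simp only [labelMeasure, Measure.pi_pi, prod_const, card_univ, Fintype.card_fin,
    ← Finset.prod_pow]
  exact prod_congr rfl fun e _ => unitLaw_one_sub_pow_lt (NeZero.ne m) (t e)

variable [Nontrivial V] {κ : ℝ → ℝ} {e : Sym2 V}

lemma measureReal_lt_normProb_le_pow (hκ : Measurable κ) (hpos : ∀ x, 0 < κ x)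
    (hanti : Antitone κ) (m : ℕ) [NeZero m] (ε : ℝ) :
    (labelMeasure (Sym2 V)).real {u | ε < normProb e (κ ∘ u)} ≤
      (labelMeasure (Sym2 V)).real
        {u | ε < normProb e ((fun w => κ (1 - (1 - w) ^ m)) ∘ u)} ^ m := by
  have hms : MeasurableSet {u : Sym2 V → ℝ | ε < normProb e (κ ∘ u)} :=
    measurableSet_lt measurable_const ((measurable_normProb e).comp (by fun_prop))
  have hpi : (Measure.pi fun _ : Fin m => labelMeasure (Sym2 V)).real (Set.univ.pi fun _ : Fin m =>
      {u : Sym2 V → ℝ | ε < normProb e ((fun w => κ (1 - (1 - w) ^ m)) ∘ u)}) =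
      (labelMeasure (Sym2 V)).real
        {u | ε < normProb e ((fun w => κ (1 - (1 - w) ^ m)) ∘ u)} ^ m := by
    simp [Measure.real, Measure.pi_pi]
  conv_lhs => rw [← map_minLabel (Sym2 V) m]
  rw [map_measureReal_apply (measurable_minLabel m) hms, ← hpi]
  refine measureReal_mono fun ω hω => Set.mem_univ_pi.2 fun i => ?_
  refine lt_of_lt_of_le hω (normProb_anti (fun f => hpos _) (fun f => ?_) e)
  exact hanti (minLabel_le ω f i)

lemma measureReal_lt_normProb_le (hκ : Measurable κ) (hpos : ∀ x, 0 < κ x)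
    (hle : ∀ x ∈ Set.Icc (0 : ℝ) 1, κ x ≤ 1) (he : ¬ e.IsDiag) {ε : ℝ} (hε : 0 ≤ ε) :
    (∫ x, κ x ∂unitLaw) * (ε * (labelMeasure (Sym2 V)).real {u | ε < normProb e (κ ∘ u)}) ≤
      2 / Fintype.card V := by
  have h1 := integral_mul_normProb_le (e := e) hκ hpos hle (ψ := fun _ => 1) measurable_const
    (fun _ _ => by simp)
  simp only [one_mul, integral_edgeProb hκ hpos he] at h1
  refine le_trans (mul_le_mul_of_nonneg_left ?_ (integral_nonneg fun x => (hpos x).le)) h1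
  refine le_trans (mul_le_mul_of_nonneg_left (measureReal_mono fun u hu => ?_) hε)
    (mul_meas_ge_le_integral_of_nonneg (μ := labelMeasure (Sym2 V))
    (ae_of_all _ fun u => normProb_nonneg (c := κ ∘ u) (fun f => hpos _) e)
    (integrable_normProb hκ hpos) ε)
  exact le_of_lt (α := ℝ) hu

end Amplification

section ExponentialWeights

lemma integral_unitLaw (f : ℝ → ℝ) : ∫ x, f x ∂unitLaw = ∫ x in (0 : ℝ)..1, f x := by
  rw [integral_Icc_eq_integral_Ioc, intervalIntegral.integral_of_le zero_le_one]

lemma integral_exp_unitLaw {s : ℝ} (hs : 0 < s) :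
    ∫ x, Real.exp (-s * x) ∂unitLaw = (1 - Real.exp (-s)) / s := by
  rw [integral_unitLaw, intervalIntegral.integral_eq_sub_of_hasDerivAt
    (f := fun x => -Real.exp (-s * x) / s)]
  · simp only [mul_one, mul_zero, Real.exp_zero]
    ring
  · intro x _
    have h := ((((hasDerivAt_id x).const_mul (-s)).exp).neg).div_const s
    refine h.congr_deriv ?_
    simp only [id]
    field_simp
  · exact Continuous.intervalIntegrable (by fun_prop) _ _

lemma integral_mul_exp_unitLaw {s : ℝ} (hs : 0 < s) :
    ∫ x, x * Real.exp (-s * x) ∂unitLaw = (1 - s * Real.exp (-s) - Real.exp (-s)) / s ^ 2 := by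
  rw [integral_unitLaw, intervalIntegral.integral_eq_sub_of_hasDerivAt
    (f := fun x => -((s * x + 1) * Real.exp (-s * x)) / s ^ 2)]
  · simp only [mul_one, mul_zero, Real.exp_zero]
    ring
  · intro x _
    have h := (((((hasDerivAt_id x).const_mul s).add_const 1).mul
      (((hasDerivAt_id x).const_mul (-s)).exp)).neg).div_const (s ^ 2)
    refine h.congr_deriv ?_
    simp only [id]
    field_simp
    ring
  · exact Continuous.intervalIntegrable (by fun_prop) _ _

/-- The mean of the exponential law of rate `s` conditioned on the unit interval. -/
def truncMean (s : ℝ) : ℝ :=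
  (1 - s * Real.exp (-s) - Real.exp (-s)) / (1 - Real.exp (-s)) / s

lemma one_sub_exp_neg_pos {s : ℝ} (hs : 0 < s) : 0 < 1 - Real.exp (-s) := by
  have : Real.exp (-s) < 1 := by simpa using hs
  linarith

lemma truncMean_mul_integral {s : ℝ} (hs : 0 < s) :
    truncMean s * ∫ x, Real.exp (-s * x) ∂unitLaw = ∫ x, x * Real.exp (-s * x) ∂unitLaw := by
  have := one_sub_exp_neg_pos hs
  rw [integral_exp_unitLaw hs, integral_mul_exp_unitLaw hs, truncMean]
  field_simp

lemma inv_le_truncMean {s : ℝ} (hs : 0 < s) : 1 / (2 + s) ≤ truncMean s := by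
  have h1 := one_sub_exp_neg_pos hs
  have h2 := Real.quadratic_le_exp_of_nonneg hs.le
  have h3 : Real.exp (-s) * Real.exp s = 1 := by rw [← Real.exp_add]; simp
  have h4 := mul_le_mul_of_nonneg_left h2 (Real.exp_pos (-s)).le
  rw [truncMean, div_div, div_le_div_iff₀ (by linarith) (by positivity)]
  nlinarith

lemma inv_le_integral_exp {s : ℝ} (hs : 0 < s) :
    1 / (1 + s) ≤ ∫ x, Real.exp (-s * x) ∂unitLaw := by
  have h2 := Real.add_one_le_exp s
  have h3 : Real.exp (-s) * Real.exp s = 1 := by rw [← Real.exp_add]; simp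
  have h4 := mul_le_mul_of_nonneg_left h2 (Real.exp_pos (-s)).le
  rw [integral_exp_unitLaw hs, div_le_div_iff₀ (by linarith) hs]
  nlinarith

lemma inv_le_integral_exp_one_sub_pow {s : ℝ} (hs : 0 < s) {m : ℕ} (hm : m ≠ 0) :
    1 / (1 + m * s) ≤ ∫ w, Real.exp (-s * (1 - (1 - w) ^ m)) ∂unitLaw := by
  have hm' : (0 : ℝ) < m := by positivity
  refine (inv_le_integral_exp (mul_pos hm' hs)).trans ?_
  rw [integral_unitLaw, integral_unitLaw]
  refine intervalIntegral.integral_mono_on zero_le_one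
    (Continuous.intervalIntegrable (by fun_prop) _ _)
    (Continuous.intervalIntegrable (by fun_prop) _ _) fun w hw => Real.exp_le_exp.2 ?_
  have := one_add_mul_le_pow (a := -w) (by linarith [hw.2]) m
  rw [← sub_eq_add_neg] at this
  nlinarith

variable [Nontrivial V] {e : Sym2 V}

lemma measureReal_lt_normProb_exp_le {s : ℝ} (hs : 0 < s) (he : ¬ e.IsDiag) {ε : ℝ} (hε : 0 < ε)
    {m : ℕ} (hm : m ≠ 0) :
    (labelMeasure (Sym2 V)).real {u | ε < normProb e ((fun x => Real.exp (-s * x)) ∘ u)} ≤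
      (2 * (1 + m * s) / (Fintype.card V * ε)) ^ m := by
  have : NeZero m := ⟨hm⟩
  refine (measureReal_lt_normProb_le_pow (by fun_prop) (fun _ => Real.exp_pos _)
    (fun x y h => Real.exp_le_exp.2 (by nlinarith)) m ε).trans
    (pow_le_pow_left₀ measureReal_nonneg ?_ m)
  have h := measureReal_lt_normProb_le (e := e) (κ := fun w => Real.exp (-s * (1 - (1 - w) ^ m)))
    (by fun_prop) (fun _ => Real.exp_pos _) (fun x hx => Real.exp_le_one_iff.2 ?_) he hε.le
  · have hV : (0 : ℝ) < Fintype.card V := by exact_mod_cast Fintype.card_pos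
    have h2 := (mul_le_mul_of_nonneg_right (inv_le_integral_exp_one_sub_pow hs hm)
      (mul_nonneg hε.le measureReal_nonneg)).trans h
    rw [div_mul_eq_mul_div, one_mul, div_le_div_iff₀ (by positivity) hV] at h2
    rw [le_div_iff₀ (by positivity)]
    linarith
  · have : (1 - x) ^ m ≤ 1 := pow_le_one₀ (by linarith [hx.2]) (by linarith [hx.1])
    nlinarith

lemma integral_label_mul_edgeProb_bounds {s : ℝ} (hs : 0 < s) (he : ¬ e.IsDiag) {ε : ℝ}
    (hε : 0 < ε) (hε1 : ε < 1) {m : ℕ} (hm : m ≠ 0) :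
    truncMean s * ((1 - ε) * (2 / Fintype.card V -
        (2 * (1 + m * s) / (Fintype.card V * ε)) ^ m)) ≤
      ∫ u, u e * edgeProb e ((fun x => Real.exp (-s * x)) ∘ u) ∂labelMeasure (Sym2 V) ∧
    ∫ u, u e * edgeProb e ((fun x => Real.exp (-s * x)) ∘ u) ∂labelMeasure (Sym2 V) ≤
      truncMean s * (2 / Fintype.card V) / (1 - ε) +
        (2 * (1 + m * s) / (Fintype.card V * ε)) ^ m := by
  have hδ := measureReal_lt_normProb_exp_le hs he hε hm
  have hκ : Measurable fun x : ℝ => Real.exp (-s * x) := by fun_prop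
  have hpos (x : ℝ) : 0 < Real.exp (-s * x) := Real.exp_pos _
  have hle : ∀ x ∈ Set.Icc (0 : ℝ) 1, Real.exp (-s * x) ≤ 1 := fun x hx =>
    Real.exp_le_one_iff.2 (by nlinarith [hx.1])
  have h1 := integral_mul_normProb_le (e := e) hκ hpos hle (ψ := fun _ => 1) measurable_const
    (fun _ _ => by simp)
  have h2 := integral_mul_edgeProb_le (e := e) hκ hpos hle (ψ := fun _ => 1) measurable_const
    (fun _ _ => by simp) hε1
  have h3 := integral_mul_normProb_le (e := e) hκ hpos hle (ψ := fun x => x) measurable_id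
    (fun _ h => h)
  have h4 := integral_mul_edgeProb_le (e := e) hκ hpos hle (ψ := fun x => x) measurable_id
    (fun _ h => h) hε1
  simp only [one_mul, integral_edgeProb hκ hpos he] at h1 h2
  rw [← truncMean_mul_integral hs, mul_assoc] at h3 h4
  have hρ : 0 ≤ truncMean s := le_trans (by positivity) (inv_le_truncMean hs)
  have hε' : 0 < 1 - ε := by linarith
  refine ⟨le_trans (mul_le_mul_of_nonneg_left ?_ hρ) h3, h4.trans (add_le_add ?_ hδ)⟩
  · have h5 := sub_le_iff_le_add.2 h2
    rw [le_div_iff₀ hε'] at h5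
    nlinarith
  · gcongr

end ExponentialWeights

lemma expLengthK_eq (n : ℕ) [Nontrivial (Fin n)] {s : ℝ} (hs : 0 < s) :
    expLengthK n s = ∑ e ∈ (⊤ : SimpleGraph (Fin n)).edgeFinset,
      ∫ u, u e * edgeProb e ((fun x => Real.exp (-s * x)) ∘ u) ∂labelMeasure (Sym2 (Fin n)) := by
  classical
  rw [expLengthK, ← integral_finsetSum]
  · refine integral_congr_ae (ae_of_all _ fun u => ?_)
    convert sum_treeWeight_mul (fun e => Real.exp (-s * u e)) u using 1
    congr!
  · intro e _
    exact integrable_mul_edgeProb (by fun_prop) (fun _ => Real.exp_pos _)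
      (fun x hx => Real.exp_le_one_iff.2 (by nlinarith [hx.1])) (ψ := fun x => x) measurable_id
      (fun _ h => h)

lemma expLengthK_bounds {n : ℕ} (hn : 2 ≤ n) {s : ℝ} (hs : 0 < s) {ε : ℝ}
    (hε : 0 < ε) (hε1 : ε < 1) {m : ℕ} (hm : m ≠ 0) :
    n * (n - 1) / 2 * (truncMean s * ((1 - ε) * (2 / n - (2 * (1 + m * s) / (n * ε)) ^ m))) ≤
      expLengthK n s ∧
    expLengthK n s ≤ n * (n - 1) / 2 * (truncMean s * (2 / n) / (1 - ε) +
        (2 * (1 + m * s) / (n * ε)) ^ m) := by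
  have : Nontrivial (Fin n) := Fin.nontrivial_iff_two_le.2 hn
  have hcard : (#(⊤ : SimpleGraph (Fin n)).edgeFinset : ℝ) = n * (n - 1) / 2 := by
    rw [SimpleGraph.card_edgeFinset_top_eq_card_choose_two, Fintype.card_fin,
      Nat.cast_choose_two]
  have h (e : Sym2 (Fin n)) (he : e ∈ (⊤ : SimpleGraph (Fin n)).edgeFinset) :=
    integral_label_mul_edgeProb_bounds (e := e) hs
      ((⊤ : SimpleGraph (Fin n)).not_isDiag_of_mem_edgeSet (SimpleGraph.mem_edgeFinset.1 he))
      hε hε1 hm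
  simp only [Fintype.card_fin] at h
  rw [expLengthK_eq n hs, ← hcard, ← nsmul_eq_mul (#_) (truncMean s * _),
    ← nsmul_eq_mul (#_) (_ + _)]
  exact ⟨card_nsmul_le_sum _ _ _ fun e he => (h e he).1,
    sum_le_card_nsmul _ _ _ fun e he => (h e he).2⟩

lemma abs_expLengthK_sub_le {n : ℕ} (hn : 2 ≤ n) {s : ℝ} (hs : 0 < s) {c : ℝ} (hc : 0 < c)
    (hc1 : c ≤ 1) {m : ℕ} (hm : m ≠ 0) (hnc : (2 + s) / n ≤ c / 4)
    (hη : (2 * (1 + m * s) / (n * (c / 4))) ^ m ≤ 1 / (n : ℝ) ^ 2) :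
    |expLengthK n s - n * truncMean s| ≤ c * (n * truncMean s) := by
  obtain ⟨h1, h2⟩ := expLengthK_bounds hn hs (ε := c / 4) (by linarith) (by linarith) hm
  have hn' : (2 : ℝ) ≤ n := by exact_mod_cast hn
  have hn0 : (0 : ℝ) < n := by linarith
  have hρ := inv_le_truncMean hs
  have hρ0 : 0 < truncMean s := lt_of_lt_of_le (by positivity) hρ
  set ρ := truncMean s
  set η := (2 * (1 + m * s) / (n * (c / 4))) ^ m
  rw [div_le_iff₀ (by linarith)] at hρ
  rw [div_le_iff₀ hn0] at hnc
  rw [le_div_iff₀ (by positivity)] at hη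
  have hη0 : 0 ≤ η := by positivity
  have hN : 0 < n * ρ := by positivity
  have h3 : n * (n - 1) / 2 * η ≤ 1 / 2 := by nlinarith
  have h4 : 1 ≤ c / 4 * (n * ρ) := by nlinarith
  have h5 : 1 / (1 - c / 4) ≤ 1 + c / 2 := by
    rw [div_le_iff₀ (by linarith)]
    nlinarith
  have h6 : 1 ≤ c / 4 * n := by linarith
  rw [abs_le]
  constructor
  · have h7 : n * (n - 1) / 2 * (ρ * ((1 - c / 4) * (2 / n - η))) =
        ρ * (1 - c / 4) * ((n - 1) - n * (n - 1) / 2 * η) := by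
      field_simp
    have h8 : (1 - c / 2) * n ≤ (n - 1) - n * (n - 1) / 2 * η := by linarith
    have h9 := mul_le_mul_of_nonneg_left h8 (mul_nonneg hρ0.le (by linarith : 0 ≤ 1 - c / 4))
    rw [h7] at h1
    have h10 : (1 - c) * (n * ρ) ≤ ρ * (1 - c / 4) * ((1 - c / 2) * n) := by
      have : 1 - c ≤ (1 - c / 4) * (1 - c / 2) := by nlinarith
      nlinarith [mul_le_mul_of_nonneg_right this hN.le]
    linarith
  · have h7 : n * (n - 1) / 2 * (ρ * (2 / n) / (1 - c / 4) + η) =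
        (n - 1) * ρ * (1 / (1 - c / 4)) + n * (n - 1) / 2 * η := by
      have : 1 - c / 4 ≠ 0 := by linarith
      field_simp
    have h8 := mul_le_mul_of_nonneg_left h5
      (mul_nonneg (by linarith : (0 : ℝ) ≤ n - 1) hρ0.le)
    nlinarith

lemma eventually_amplification {β : ℕ → ℝ} (hβpos : ∀ n, 0 < β n)
    (hβ : Tendsto (fun n : ℕ => β n / ((n : ℝ) / Real.log n)) atTop (nhds 0)) {c : ℝ}
    (hc : 0 < c) :
    ∀ᶠ n : ℕ in atTop, (2 + β n) / n ≤ c ∧ ∃ m : ℕ, m ≠ 0 ∧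
      (2 * (1 + m * β n) / (n * c)) ^ m ≤ 1 / (n : ℝ) ^ 2 := by
  have h1 : Tendsto (fun n : ℕ => (n : ℝ)⁻¹) atTop (nhds 0) :=
    tendsto_inv_atTop_zero.comp tendsto_natCast_atTop_atTop
  have h2 := (h1.const_mul 2).add hβ
  have h3 := (h1.const_mul (2 / c)).add (hβ.const_mul (6 / c))
  simp only [mul_zero, add_zero] at h2 h3
  filter_upwards [h2.eventually_le_const hc, h3.eventually_le_const (Real.exp_pos (-1)),
    eventually_ge_atTop 3] with n h2 h3 hn
  have hn' : (3 : ℝ) ≤ n := by exact_mod_cast hn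
  have hlog : 1 ≤ Real.log n := by
    rw [Real.le_log_iff_exp_le (by linarith)]
    linarith [Real.exp_one_lt_d9]
  have hβn := hβpos n
  rw [div_div_eq_mul_div] at h2 h3
  refine ⟨le_trans ?_ h2, ⌈2 * Real.log n⌉₊, (Nat.ceil_pos.2 (by linarith)).ne', ?_⟩
  · rw [add_div, div_eq_mul_inv 2]
    gcongr
    exact le_mul_of_one_le_right hβn.le hlog
  have hm1 := Nat.le_ceil (2 * Real.log n)
  have hm2 := (Nat.ceil_lt_add_one (by linarith : 0 ≤ 2 * Real.log n)).le
  set m := ⌈2 * Real.log n⌉₊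
  have hb : 2 * (1 + m * β n) / (n * c) ≤ Real.exp (-1) := by
    refine le_trans ?_ h3
    have h5 : 2 / c * (n : ℝ)⁻¹ + 6 / c * (β n * Real.log n / n) =
        2 * (1 + 3 * Real.log n * β n) / (n * c) := by
      field_simp
      ring
    rw [h5]
    gcongr
    linarith
  calc (2 * (1 + m * β n) / (n * c)) ^ m ≤ Real.exp (-1) ^ m := by gcongr
    _ = Real.exp (-m) := by rw [← Real.exp_nat_mul]; simp
    _ ≤ Real.exp (-(2 * Real.log n)) := by gcongr
    _ = 1 / (n : ℝ) ^ 2 := by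
      rw [Real.exp_neg, mul_comm, Real.exp_mul, Real.exp_log (by linarith), one_div]
      norm_num

/-- If `βₙ ≪ n/log n`, then
`E[L(WST^{βₙ}(Kₙ))] = (1+o(1))·(n/βₙ)·(1 - βₙe^{-βₙ} - e^{-βₙ})/(1 - e^{-βₙ})`. -/
theorem expected_length_ust_phase (β : ℕ → ℝ)
    (hβpos : ∀ n, 0 < β n)
    (hβ : Tendsto (fun n : ℕ => β n / ((n : ℝ) / Real.log n)) atTop (nhds 0)) :
    (fun n : ℕ => expLengthK n (β n) -
        ((n : ℝ) / β n) * ((1 - β n * Real.exp (-β n) - Real.exp (-β n)) /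
          (1 - Real.exp (-β n))))
      =o[atTop] fun n : ℕ =>
        ((n : ℝ) / β n) * ((1 - β n * Real.exp (-β n) - Real.exp (-β n)) /
          (1 - Real.exp (-β n))) := by
  have htarget (n : ℕ) : ((n : ℝ) / β n) * ((1 - β n * Real.exp (-β n) - Real.exp (-β n)) /
      (1 - Real.exp (-β n))) = n * truncMean (β n) := by
    rw [truncMean, div_mul_eq_mul_div, mul_div_assoc]
  simp only [htarget]
  refine Asymptotics.isLittleO_iff.2 fun c hc => ?_
  have hc' : 0 < min c 1 := lt_min hc one_pos
  filter_upwards [eventually_amplification hβpos hβ (c := min c 1 / 4) (by positivity),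
    eventually_ge_atTop 2] with n ⟨h1, m, hm, h2⟩ hn
  have hρ : 0 ≤ n * truncMean (β n) :=
    mul_nonneg n.cast_nonneg
      (le_trans (by have := hβpos n; positivity) (inv_le_truncMean (hβpos n)))
  rw [Real.norm_eq_abs, Real.norm_of_nonneg hρ]
  exact (abs_expLengthK_sub_le hn (hβpos n) hc' (min_le_right _ _) hm h1 h2).trans
    (mul_le_mul_of_nonneg_right (min_le_left _ _) hρ)

end WSTPaper
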